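/- arXiv:2601.22101 — 10 statements merged into one kernel-verified Lean document; each statement's English description precedes it below -/
import Mathlib

section
/- Virtual Sequence Dynamics (Lemma 3.1): Under the ECO-SGDM recursion with injection strength α = (1/η)(1 − 1/β), the virtual sequence θ_t := θ̂_t − (ηβ/(1−β))·m̂_t satisfies, for every t ≥ 0, θ_{t+1} = θ_t − η·∇f(θ̂_t). -/
/-- **Virtual Sequence Dynamics (Lemma 3.1).**
Under the ECO-SGDM recursion with injection strength `α = (1/η)(1 − 1/β)`,
the virtual sequence `θ t = θ̂ t − (ηβ/(1−β)) • m̂ t` satisfies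
`θ (t+1) = θ t − η • ∇f(θ̂ t)` for every `t`. -/
theorem eco_virtual_sequence_dynamics
    {d : ℕ} (f : EuclideanSpace ℝ (Fin d) → ℝ) (hf : Differentiable ℝ f)
    (η β : ℝ) (hη : 0 < η) (hβ : β ∈ Set.Ioo (0 : ℝ) 1)
    (q : EuclideanSpace ℝ (Fin d) → EuclideanSpace ℝ (Fin d))
    (thetaHat mHat mTilde thetaTilde err : ℕ → EuclideanSpace ℝ (Fin d))
    (hmTilde : ∀ t, mTilde (t + 1)
      = β • mHat t + (1 - β) • gradient f (thetaHat t))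
    (hthetaTilde : ∀ t, thetaTilde (t + 1) = thetaHat t - η • mTilde (t + 1))
    (hthetaHat : ∀ t, thetaHat (t + 1) = q (thetaTilde (t + 1)))
    (herr : ∀ t, err (t + 1) = thetaTilde (t + 1) - thetaHat (t + 1))
    (hmHat : ∀ t, mHat (t + 1)
      = mTilde (t + 1) + ((1 / η) * (1 - 1 / β)) • err (t + 1))
    (theta : ℕ → EuclideanSpace ℝ (Fin d))
    (htheta : ∀ t, theta t = thetaHat t - (η * β / (1 - β)) • mHat t) :
    ∀ t, theta (t + 1) = theta t - η • gradient f (thetaHat t) := by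
  intro t
  have hβ0 : β ≠ 0 := hβ.1.ne'
  have hβ1 : 1 - β ≠ 0 := (sub_pos.mpr hβ.2).ne'
  have hη0 : η ≠ 0 := hη.ne'
  rw [htheta, htheta, hmHat, herr, hthetaTilde, hmTilde]
  match_scalars <;> field_simp <;> ring
end

section
/- Descent Lemma (Lemma 3.2): Suppose f is L-smooth and η ≤ 1/(2L). Let C = ηβ/(1−β). Then under the ECO-SGDM recursion with injection strength α = (1/η)(1 − 1/β), the virtual sequence θ_t := θ̂_t − (ηβ/(1−β))·m̂_t satisfies, for every t ≥ 0, f(θ_{t+1}) ≤ f(θ_t) − (η/4)·‖∇f(θ̂_t)‖² + (η·L²·C²/2)·‖m̂_t‖². -/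
/-- The quadratic upper bound for a function with `L`-Lipschitz gradient. -/
theorem le_add_inner_gradient_add_sq {E : Type*} [NormedAddCommGroup E] [InnerProductSpace ℝ E]
    [CompleteSpace E] {f : E → ℝ} (hf : Differentiable ℝ f) {L : ℝ}
    (hL : ∀ x y, ‖gradient f x - gradient f y‖ ≤ L * ‖x - y‖) (x v : E) :
    f (x + v) ≤ f x + inner ℝ (gradient f x) v + L / 2 * ‖v‖ ^ 2 := by
  have hderiv (s : ℝ) : HasDerivAt
      (fun s : ℝ ↦ f (x + s • v) - s * inner ℝ (gradient f x) v - L / 2 * ‖v‖ ^ 2 * s ^ 2)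
      (inner ℝ (gradient f (x + s • v)) v - inner ℝ (gradient f x) v - L * ‖v‖ ^ 2 * s) s := by
    have hline : HasDerivAt (fun s : ℝ ↦ x + s • v) v s := by
      simpa using ((hasDerivAt_id s).smul_const v).const_add x
    have hcomp := (hf (x + s • v)).hasGradientAt.hasFDerivAt.comp_hasDerivAt s hline
    have hlin := (hasDerivAt_id s).mul_const (inner ℝ (gradient f x) v)
    have hquad := ((hasDerivAt_id s).pow 2).const_mul (L / 2 * ‖v‖ ^ 2)
    refine ((hcomp.sub hlin).sub hquad).congr_deriv ?_
    simp
    ring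
  have hanti := antitoneOn_of_deriv_nonpos (convex_Icc (0 : ℝ) 1)
    (fun s _ ↦ (hderiv s).continuousAt.continuousWithinAt)
    (fun s _ ↦ (hderiv s).differentiableAt.differentiableWithinAt) (fun s hs ↦ by
      rw [interior_Icc] at hs
      rw [(hderiv s).deriv, ← inner_sub_left]
      have hgrad := hL (x + s • v) x
      rw [add_sub_cancel_left, norm_smul, Real.norm_of_nonneg hs.1.le] at hgrad
      nlinarith [real_inner_le_norm (gradient f (x + s • v) - gradient f x) v,
        mul_le_mul_of_nonneg_right hgrad (norm_nonneg v)])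
  have h := hanti (Set.left_mem_Icc.2 zero_le_one) (Set.right_mem_Icc.2 zero_le_one) zero_le_one
  simp only [one_smul, zero_smul, add_zero] at h
  linarith

/-- One step of gradient descent along an inexact gradient `g`. -/
theorem apply_sub_smul_le_of_inexact_gradient {E : Type*} [NormedAddCommGroup E]
    [InnerProductSpace ℝ E] [CompleteSpace E] {f : E → ℝ} (hf : Differentiable ℝ f) {L η : ℝ}
    (hL : ∀ x y, ‖gradient f x - gradient f y‖ ≤ L * ‖x - y‖) (hη : 0 ≤ η)
    (hηL : η * L ≤ 1 / 2) (x g : E) :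
    f (x - η • g) ≤ f x - η / 4 * ‖g‖ ^ 2 + η / 2 * ‖gradient f x - g‖ ^ 2 := by
  have h := le_add_inner_gradient_add_sq hf hL x (-(η • g))
  rw [← sub_eq_add_neg, inner_neg_right, inner_smul_right, norm_neg, norm_smul,
    Real.norm_of_nonneg hη] at h
  have hsq := norm_sub_sq_real (gradient f x) g
  have hstep := mul_le_mul_of_nonneg_right hηL (mul_nonneg hη (sq_nonneg ‖g‖))
  rw [hsq]
  nlinarith [mul_nonneg hη (sq_nonneg ‖gradient f x‖)]


/-- **Descent Lemma (Lemma 3.2).**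
If `f` is `L`-smooth and `η ≤ 1/(2L)`, then with `C = ηβ/(1−β)` the virtual
sequence `θ t = θ̂ t − (ηβ/(1−β)) • m̂ t` of the ECO-SGDM recursion satisfies
`f (θ (t+1)) ≤ f (θ t) − (η/4)‖∇f(θ̂ t)‖² + (ηL²C²/2)‖m̂ t‖²`. -/
theorem eco_descent_lemma
    {d : ℕ} (f : EuclideanSpace ℝ (Fin d) → ℝ) (hf : Differentiable ℝ f)
    (η β L : ℝ) (hη : 0 < η) (hβ : β ∈ Set.Ioo (0 : ℝ) 1) (hL : 0 < L)
    (hsmooth : ∀ x y, ‖gradient f x - gradient f y‖ ≤ L * ‖x - y‖)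
    (hηL : η ≤ 1 / (2 * L))
    (q : EuclideanSpace ℝ (Fin d) → EuclideanSpace ℝ (Fin d))
    (thetaHat mHat mTilde thetaTilde err : ℕ → EuclideanSpace ℝ (Fin d))
    (hmTilde : ∀ t, mTilde (t + 1)
      = β • mHat t + (1 - β) • gradient f (thetaHat t))
    (hthetaTilde : ∀ t, thetaTilde (t + 1) = thetaHat t - η • mTilde (t + 1))
    (hthetaHat : ∀ t, thetaHat (t + 1) = q (thetaTilde (t + 1)))
    (herr : ∀ t, err (t + 1) = thetaTilde (t + 1) - thetaHat (t + 1))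
    (hmHat : ∀ t, mHat (t + 1)
      = mTilde (t + 1) + ((1 / η) * (1 - 1 / β)) • err (t + 1))
    (theta : ℕ → EuclideanSpace ℝ (Fin d))
    (htheta : ∀ t, theta t = thetaHat t - (η * β / (1 - β)) • mHat t)
    (C : ℝ) (hC : C = η * β / (1 - β)) :
    ∀ t, f (theta (t + 1))
      ≤ f (theta t) - (η / 4) * ‖gradient f (thetaHat t)‖ ^ 2
        + (η * L ^ 2 * C ^ 2 / 2) * ‖mHat t‖ ^ 2 := by
  intro t
  obtain ⟨hβ0, hβ1⟩ := hβ
  have hβ' : 1 - β ≠ 0 := by linarith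
  have hstep : theta (t + 1) = theta t - η • gradient f (thetaHat t) := by
    have hhat : thetaHat (t + 1) = thetaTilde (t + 1) - err (t + 1) := by
      rw [herr, sub_sub_cancel]
    rw [htheta, htheta, hmHat, hhat, hthetaTilde, hmTilde]
    match_scalars <;> field_simp <;> ring
  have hηL' : η * L ≤ 1 / 2 := by
    rw [le_div_iff₀ (by positivity)] at hηL
    linarith
  have hdescent := apply_sub_smul_le_of_inexact_gradient hf hsmooth hη.le hηL'
    (theta t) (gradient f (thetaHat t))
  have hgrad : ‖gradient f (theta t) - gradient f (thetaHat t)‖ ^ 2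
      ≤ L ^ 2 * C ^ 2 * ‖mHat t‖ ^ 2 := by
    have h := hsmooth (theta t) (thetaHat t)
    rw [htheta t, sub_sub_cancel_left, norm_neg, norm_smul, ← hC] at h
    rw [htheta t, ← hC]
    calc _ ≤ (L * (‖C‖ * ‖mHat t‖)) ^ 2 := by gcongr
      _ = _ := by rw [mul_pow, mul_pow, Real.norm_eq_abs, sq_abs, mul_assoc]
  rw [hstep]
  nlinarith [mul_le_mul_of_nonneg_left hgrad hη.le]
end

section
/- Deterministic Momentum Bound (Lemma 3.5): Suppose m̂_0 = 0, the gradient is uniformly bounded (‖∇f(θ)‖ ≤ G for all θ), and the quantization errors are uniformly bounded (‖e_t‖ ≤ δ for all t). Then under the ECO-SGDM recursion with injection strength α = (1/η)(1 − 1/β), for every t ≥ 0, ‖m̂_t‖ ≤ G + |α|·δ/(1 − β). -/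
/-- A sequence obeying the affine recursive bound `‖u (t + 1)‖ ≤ β ‖u t‖ + (1 - β) G + c` and
starting at `0` stays below the fixed point `G + c / (1 - β)`. -/
theorem norm_le_of_affine_recursion {E : Type*} [SeminormedAddCommGroup E] {u : ℕ → E}
    {β G c : ℝ} (hβ₀ : 0 ≤ β) (hβ₁ : β < 1) (hG : 0 ≤ G) (hc : 0 ≤ c) (h0 : u 0 = 0)
    (hu : ∀ t, ‖u (t + 1)‖ ≤ β * ‖u t‖ + (1 - β) * G + c) (t : ℕ) :
    ‖u t‖ ≤ G + c / (1 - β) := by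
  have hpos : 0 < 1 - β := sub_pos.2 hβ₁
  induction t with
  | zero => rw [h0, norm_zero]; positivity
  | succ t ih =>
    calc ‖u (t + 1)‖ ≤ β * ‖u t‖ + (1 - β) * G + c := hu t
      _ ≤ β * (G + c / (1 - β)) + (1 - β) * G + c := by gcongr
      _ = G + c / (1 - β) := by field_simp; ring

/-- **Deterministic Momentum Bound (Lemma 3.5).**
If `m̂ 0 = 0`, the gradient is uniformly bounded by `G` and the quantization
errors are uniformly bounded by `δ`, then under the ECO-SGDM recursion with
injection strength `α = (1/η)(1 − 1/β)` one has
`‖m̂ t‖ ≤ G + |α| δ / (1 − β)` for all `t`. -/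
theorem eco_deterministic_momentum_bound
    {d : ℕ} (f : EuclideanSpace ℝ (Fin d) → ℝ) (hf : Differentiable ℝ f)
    (η β G δ : ℝ) (hη : 0 < η) (hβ : β ∈ Set.Ioo (0 : ℝ) 1)
    (q : EuclideanSpace ℝ (Fin d) → EuclideanSpace ℝ (Fin d))
    (thetaHat mHat mTilde thetaTilde err : ℕ → EuclideanSpace ℝ (Fin d))
    (hmTilde : ∀ t, mTilde (t + 1)
      = β • mHat t + (1 - β) • gradient f (thetaHat t))
    (hthetaTilde : ∀ t, thetaTilde (t + 1) = thetaHat t - η • mTilde (t + 1))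
    (hthetaHat : ∀ t, thetaHat (t + 1) = q (thetaTilde (t + 1)))
    (herr : ∀ t, err (t + 1) = thetaTilde (t + 1) - thetaHat (t + 1))
    (hmHat : ∀ t, mHat (t + 1)
      = mTilde (t + 1) + ((1 / η) * (1 - 1 / β)) • err (t + 1))
    (hm0 : mHat 0 = 0)
    (hG : ∀ x, ‖gradient f x‖ ≤ G)
    (hδ : ∀ t, ‖err t‖ ≤ δ) :
    ∀ t, ‖mHat t‖ ≤ G + |(1 / η) * (1 - 1 / β)| * δ / (1 - β) := by
  obtain ⟨hβ₀, hβ₁⟩ := hβ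
  have hG₀ : 0 ≤ G := (norm_nonneg _).trans (hG 0)
  have hδ₀ : 0 ≤ δ := (norm_nonneg _).trans (hδ 0)
  refine norm_le_of_affine_recursion hβ₀.le hβ₁ hG₀ (by positivity) hm0 fun t => ?_
  rw [hmHat, hmTilde]
  refine norm_add₃_le.trans ?_
  rw [norm_smul, norm_smul, norm_smul, Real.norm_of_nonneg hβ₀.le,
    Real.norm_of_nonneg (sub_nonneg.2 hβ₁.le), Real.norm_eq_abs]
  have := sub_nonneg.2 hβ₁.le
  gcongr
  · exact hG _
  · exact hδ _
end

section
/- Deterministic Convergence (Theorem 3.6): Suppose f is L-smooth and bounded below by f*, the gradient is uniformly bounded (‖∇f(θ)‖ ≤ G for all θ), the quantization errors are uniformly bounded (‖e_t‖ ≤ δ for all t), m̂_0 = 0, and η ≤ 1/(2L). Then for every T ≥ 1, min over t ∈ {0, …, T−1} of ‖∇f(θ̂_t)‖² ≤ 4(f(θ_0) − f*)/(ηT) + Γ_quant², where θ_0 = θ̂_0 − (ηβ/(1−β))·m̂_0 and Γ_quant² = (2L²η²β²/(1−β)²)·(G + |α|·δ/(1−β))², with α = (1/η)(1 − 1/β).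 -/
open scoped InnerProductSpace in
/-- The descent lemma: a differentiable function with `L`-Lipschitz gradient lies below its
quadratic upper model. -/
theorem descent_of_lipschitz_gradient {E : Type*} [NormedAddCommGroup E] [InnerProductSpace ℝ E]
    [CompleteSpace E] {f : E → ℝ} (hf : Differentiable ℝ f) {L : ℝ}
    (hsmooth : ∀ x y, ‖gradient f x - gradient f y‖ ≤ L * ‖x - y‖) (x v : E) :
    f (x + v) ≤ f x + ⟪gradient f x, v⟫_ℝ + L / 2 * ‖v‖ ^ 2 := by
  have hderiv (s : ℝ) : HasDerivAt
      (fun s : ℝ => f (x + s • v) - s * ⟪gradient f x, v⟫_ℝ - L / 2 * ‖v‖ ^ 2 * s ^ 2)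
      (⟪gradient f (x + s • v), v⟫_ℝ - ⟪gradient f x, v⟫_ℝ - L * ‖v‖ ^ 2 * s) s := by
    have hline : HasDerivAt (fun s : ℝ => x + s • v) v s := by
      simpa using ((hasDerivAt_id s).smul_const v).const_add x
    have hcomp := (hf (x + s • v)).hasGradientAt.hasFDerivAt.comp_hasDerivAt s hline
    have hquad : HasDerivAt (fun s : ℝ => L / 2 * ‖v‖ ^ 2 * s ^ 2) (L * ‖v‖ ^ 2 * s) s :=
      ((hasDerivAt_pow 2 s).const_mul (L / 2 * ‖v‖ ^ 2)).congr_deriv (by simp; ring)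
    exact ((hcomp.sub ((hasDerivAt_id s).mul_const _)).sub hquad).congr_deriv (by simp)
  obtain ⟨s, hs, hslope⟩ := exists_hasDerivAt_eq_slope _ _ zero_lt_one
    (fun s _ => (hderiv s).continuousAt.continuousWithinAt) (fun s _ => hderiv s)
  have hgrad : ⟪gradient f (x + s • v) - gradient f x, v⟫_ℝ ≤ L * ‖v‖ ^ 2 * s := by
    have hnorm : ‖x + s • v - x‖ = s * ‖v‖ := by
      rw [add_sub_cancel_left, norm_smul, Real.norm_of_nonneg hs.1.le]
    calc ⟪gradient f (x + s • v) - gradient f x, v⟫_ℝ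
        ≤ ‖gradient f (x + s • v) - gradient f x‖ * ‖v‖ := real_inner_le_norm _ _
      _ ≤ L * (s * ‖v‖) * ‖v‖ := by
          gcongr
          exact hnorm ▸ hsmooth (x + s • v) x
      _ = L * ‖v‖ ^ 2 * s := by ring
  rw [inner_sub_left] at hgrad
  simp only [one_smul, zero_smul, add_zero, sub_zero, div_one, one_mul, zero_mul, one_pow,
    mul_one, ne_eq, OfNat.ofNat_ne_zero, not_false_eq_true, zero_pow, mul_zero] at hslope
  linarith

open scoped InnerProductSpace in
/-- One gradient step from `x`, with the gradient evaluated at a nearby point `y`. -/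
theorem descent_step_perturbed {E : Type*} [NormedAddCommGroup E] [InnerProductSpace ℝ E]
    [CompleteSpace E] {f : E → ℝ} (hf : Differentiable ℝ f) {L η r : ℝ} (hη : 0 ≤ η)
    (hL : 0 ≤ L) (hηL : η * L ≤ 1 / 2)
    (hsmooth : ∀ x y, ‖gradient f x - gradient f y‖ ≤ L * ‖x - y‖) (x y : E)
    (hr : ‖x - y‖ ≤ r) :
    f (x - η • gradient f y) ≤ f x - (η / 4 * ‖gradient f y‖ ^ 2 - η / 2 * (L * r) ^ 2) := by
  have hdesc := descent_of_lipschitz_gradient hf hsmooth x (-(η • gradient f y))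
  rw [← sub_eq_add_neg, inner_neg_right, real_inner_smul_right, norm_neg, norm_smul,
    Real.norm_of_nonneg hη] at hdesc
  have hdist : ‖gradient f x - gradient f y‖ ^ 2 ≤ (L * r) ^ 2 := by
    gcongr
    exact (hsmooth x y).trans (by gcongr)
  rw [norm_sub_sq_real] at hdist
  have hpolar := mul_le_mul_of_nonneg_left hdist hη
  have hstep := mul_le_mul_of_nonneg_right hηL (mul_nonneg hη (sq_nonneg ‖gradient f y‖))
  have hsq := mul_nonneg hη (sq_nonneg ‖gradient f x‖)
  linarith

/-- A sequence of vectors contracted by `β` and perturbed by at most `(1 - β) * M` at each step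
stays in the ball of radius `M`. -/
theorem norm_le_of_contraction_step {E : Type*} [SeminormedAddCommGroup E] {β M : ℝ}
    (hβ : 0 ≤ β) {m : ℕ → E} (h0 : ‖m 0‖ ≤ M)
    (hstep : ∀ t, ‖m (t + 1)‖ ≤ β * ‖m t‖ + (1 - β) * M) (t : ℕ) : ‖m t‖ ≤ M := by
  induction t with
  | zero => exact h0
  | succ t ih => linarith [hstep t, mul_le_mul_of_nonneg_left ih hβ]


/-- **Deterministic Convergence (Theorem 3.6).**
If `f` is `L`-smooth and bounded below by `f*`, gradients are bounded by `G`,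
quantization errors are bounded by `δ`, `m̂ 0 = 0` and `η ≤ 1/(2L)`, then for
every `T ≥ 1`,
`min_{t < T} ‖∇f(θ̂ t)‖² ≤ 4 (f θ₀ − f*) / (η T) + Γ_quant²`,
where `θ₀ = θ̂ 0 − (ηβ/(1−β)) • m̂ 0` and
`Γ_quant² = (2L²η²β²/(1−β)²) (G + |α| δ/(1−β))²` with `α = (1/η)(1 − 1/β)`. -/
theorem eco_deterministic_convergence
    {d : ℕ} (f : EuclideanSpace ℝ (Fin d) → ℝ) (hf : Differentiable ℝ f)
    (η β L G δ fstar : ℝ) (hη : 0 < η) (hβ : β ∈ Set.Ioo (0 : ℝ) 1) (hL : 0 < L)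
    (hsmooth : ∀ x y, ‖gradient f x - gradient f y‖ ≤ L * ‖x - y‖)
    (hbdd : ∀ x, fstar ≤ f x)
    (hG : ∀ x, ‖gradient f x‖ ≤ G)
    (hηL : η ≤ 1 / (2 * L))
    (q : EuclideanSpace ℝ (Fin d) → EuclideanSpace ℝ (Fin d))
    (thetaHat mHat mTilde thetaTilde err : ℕ → EuclideanSpace ℝ (Fin d))
    (hmTilde : ∀ t, mTilde (t + 1)
      = β • mHat t + (1 - β) • gradient f (thetaHat t))
    (hthetaTilde : ∀ t, thetaTilde (t + 1) = thetaHat t - η • mTilde (t + 1))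
    (hthetaHat : ∀ t, thetaHat (t + 1) = q (thetaTilde (t + 1)))
    (herr : ∀ t, err (t + 1) = thetaTilde (t + 1) - thetaHat (t + 1))
    (hmHat : ∀ t, mHat (t + 1)
      = mTilde (t + 1) + ((1 / η) * (1 - 1 / β)) • err (t + 1))
    (hm0 : mHat 0 = 0)
    (hδ : ∀ t, ‖err t‖ ≤ δ)
    (theta0 : EuclideanSpace ℝ (Fin d))
    (htheta0 : theta0 = thetaHat 0 - (η * β / (1 - β)) • mHat 0)
    (T : ℕ) (hT : 1 ≤ T) :
    (Finset.range T).inf' (Finset.nonempty_range_iff.mpr (Nat.one_le_iff_ne_zero.mp hT))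
        (fun t => ‖gradient f (thetaHat t)‖ ^ 2)
      ≤ 4 * (f theta0 - fstar) / (η * T)
        + (2 * L ^ 2 * η ^ 2 * β ^ 2 / (1 - β) ^ 2)
          * (G + |(1 / η) * (1 - 1 / β)| * δ / (1 - β)) ^ 2 := by
  obtain ⟨hβ0, hβ1⟩ := hβ
  have hβ' : 0 < 1 - β := sub_pos.2 hβ1
  set α := (1 / η) * (1 - 1 / β) with hα
  set M := G + |α| * δ / (1 - β) with hM
  set c := η * β / (1 - β) with hc
  have hc0 : 0 ≤ c := by positivity
  have hδ0 : 0 ≤ δ := (norm_nonneg _).trans (hδ 0)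
  have hG0 : 0 ≤ G := (norm_nonneg _).trans (hG 0)
  have hM0 : 0 ≤ M := by positivity
  have hMβ : (1 - β) * M = (1 - β) * G + |α| * δ := by
    rw [hM]
    field_simp
  have hmom : ∀ t, ‖mHat t‖ ≤ M := by
    refine norm_le_of_contraction_step hβ0.le (by simpa [hm0] using hM0) fun t => ?_
    rw [hmHat, hmTilde, hMβ, ← add_assoc]
    refine (norm_add₃_le).trans ?_
    rw [norm_smul, norm_smul, norm_smul, Real.norm_of_nonneg hβ0.le,
      Real.norm_of_nonneg hβ'.le, Real.norm_eq_abs]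
    gcongr
    · exact hG _
    · exact hδ _
  have hvirtual : ∀ t, thetaHat (t + 1) - c • mHat (t + 1)
      = (thetaHat t - c • mHat t) - η • gradient f (thetaHat t) := by
    intro t
    have hcα : c * α = -1 := by
      rw [hc, hα]
      field_simp
      ring
    have hcβ : (η + c) * β = c := by
      rw [hc]
      field_simp
      ring
    have hcη : (η + c) * (1 - β) = η := by
      rw [hc]
      field_simp
      ring
    have hθ : thetaHat (t + 1) = thetaHat t - η • mTilde (t + 1) - err (t + 1) := by
      rw [herr, hthetaTilde]
      abel
    calc thetaHat (t + 1) - c • mHat (t + 1)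
        = thetaHat t - (η + c) • mTilde (t + 1) - (1 + c * α) • err (t + 1) := by
          rw [hmHat, hθ]
          module
      _ = thetaHat t - ((η + c) * β) • mHat t
            - ((η + c) * (1 - β)) • gradient f (thetaHat t) := by
          rw [hcα, hmTilde]
          module
      _ = _ := by rw [hcβ, hcη]
  have hηL' : η * L ≤ 1 / 2 := by
    rw [le_div_iff₀ (by positivity)] at hηL
    linarith
  set μ := (Finset.range T).inf' (Finset.nonempty_range_iff.mpr (Nat.one_le_iff_ne_zero.mp hT))
    (fun t => ‖gradient f (thetaHat t)‖ ^ 2) with hμ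
  have hdescent : ∀ n ≤ T, f (thetaHat n - c • mHat n)
      ≤ f theta0 - n * (η / 4 * μ - η / 2 * (L * (c * M)) ^ 2) := by
    intro n
    induction n with
    | zero => simp [htheta0]
    | succ n ih =>
      intro hn
      have hμn : μ ≤ ‖gradient f (thetaHat n)‖ ^ 2 :=
        Finset.inf'_le _ (Finset.mem_range.2 hn)
      have hdist : ‖thetaHat n - c • mHat n - thetaHat n‖ ≤ c * M := by
        rw [sub_sub_cancel_left, norm_neg, norm_smul, Real.norm_of_nonneg hc0]
        gcongr
        exact hmom n
      have hstep := descent_step_perturbed hf hη.le hL.le hηL' hsmooth _ _ hdist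
      have hημ := mul_le_mul_of_nonneg_left hμn (by positivity : 0 ≤ η / 4)
      rw [hvirtual]
      push_cast
      linarith [ih (Nat.le_of_succ_le hn)]
  have hT0 : (0 : ℝ) < T := by exact_mod_cast hT
  have hΓ : 2 * L ^ 2 * η ^ 2 * β ^ 2 / (1 - β) ^ 2 * M ^ 2 = 2 * (L * (c * M)) ^ 2 := by
    rw [hc]
    field_simp
  rw [hΓ, ← sub_le_iff_le_add, le_div_iff₀ (by positivity)]
  linarith [hdescent T le_rfl, hbdd (thetaHat T - c • mHat T)]
end

section
/- Exact equivalence of ideal error injection (Appendix A Theorem): Under the initialization θ̂^IM_0 = q(θ_0), e^IM_0 = θ_0 − θ̂^IM_0, m^IM_0 = m^MW_0 − (1/(ηβ))·e^IM_0, the quantized iterates of the ideal-injection method coincide with those of SGDM with master weights: for every t ≥ 0, θ̂^IM_t = θ̂^MW_t, where θ̂^MW_t = q(θ_t). -/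
/-- **Exact equivalence of ideal error injection (Appendix A).**
With initialization `θ̂IM 0 = q (θ 0)`, `eIM 0 = θ 0 − θ̂IM 0`,
`mIM 0 = mMW 0 − (1/(ηβ)) • eIM 0`, the quantized iterates of the
ideal-injection method coincide with those of SGDM with master weights:
`θ̂IM t = q (θ t)` for all `t`. -/
theorem eco_exact_error_injection_equivalence
    {d : ℕ} (f : EuclideanSpace ℝ (Fin d) → ℝ) (hf : Differentiable ℝ f)
    (η β : ℝ) (hη : 0 < η) (hβ : β ∈ Set.Ioo (0 : ℝ) 1)
    (q : EuclideanSpace ℝ (Fin d) → EuclideanSpace ℝ (Fin d))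
    -- SGDM with master weights
    (theta mMW : ℕ → EuclideanSpace ℝ (Fin d))
    (hmMW : ∀ t, mMW (t + 1)
      = β • mMW t + (1 - β) • gradient f (q (theta t)))
    (htheta : ∀ t, theta (t + 1) = theta t - η • mMW (t + 1))
    -- ideal-injection method
    (thetaHatIM mIM eIM mBar thetaTilde : ℕ → EuclideanSpace ℝ (Fin d))
    (hmBar : ∀ t, mBar (t + 1)
      = β • mIM t + (1 - β) • gradient f (thetaHatIM t))
    (hthetaTilde : ∀ t, thetaTilde (t + 1) = thetaHatIM t - η • mBar (t + 1))
    (hthetaHatIM : ∀ t, thetaHatIM (t + 1) = q (thetaTilde (t + 1)))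
    (heIM : ∀ t, eIM (t + 1) = thetaTilde (t + 1) - thetaHatIM (t + 1))
    (hmIM : ∀ t, mIM (t + 1)
      = mBar (t + 1) + (1 / η) • eIM t - (1 / (η * β)) • eIM (t + 1))
    -- initialization
    (hinit_theta : thetaHatIM 0 = q (theta 0))
    (hinit_e : eIM 0 = theta 0 - thetaHatIM 0)
    (hinit_m : mIM 0 = mMW 0 - (1 / (η * β)) • eIM 0) :
    ∀ t, thetaHatIM t = q (theta t) := by
  have hη0 : η ≠ 0 := hη.ne'
  have hβ0 : β ≠ 0 := hβ.1.ne'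
  have invariant : ∀ t, thetaHatIM t = q (theta t) ∧ eIM t = theta t - thetaHatIM t ∧
      mIM t = mMW t - (1 / (η * β)) • eIM t := by
    intro t
    induction t with
    | zero => exact ⟨hinit_theta, hinit_e, hinit_m⟩
    | succ t ih =>
      obtain ⟨h_hat, h_e, h_m⟩ := ih
      have h_bar : mBar (t + 1) = mMW (t + 1) - (1 / η) • eIM t := by
        rw [hmBar, hmMW, h_m, h_hat]
        match_scalars <;> field_simp
      have h_tilde : thetaTilde (t + 1) = theta (t + 1) := by
        rw [hthetaTilde, htheta, h_bar, h_e]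
        match_scalars <;> field_simp <;> ring
      refine ⟨by rw [hthetaHatIM, h_tilde], by rw [heIM, h_tilde], ?_⟩
      rw [hmIM, h_bar, sub_add_cancel]
  exact fun t => (invariant t).1
end

section
/- Implicit master-weight update for ideal injection (Appendix A): Define the implicit master weights θ*_t := θ̂^IM_t + e^IM_t and implicit momentum m*_t := m^IM_t + (1/(ηβ))·e^IM_t. Then under the ideal-injection recursion, for every t ≥ 0, θ*_{t+1} = θ*_t − η·m*_{t+1}. -/
/-- **Implicit master-weight update for ideal injection (Appendix A).**
With the implicit master weights `θ* t = θ̂IM t + eIM t` and implicit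
momentum `m* t = mIM t + (1/(ηβ)) • eIM t`, the ideal-injection recursion
yields `θ* (t+1) = θ* t − η • m* (t+1)` for all `t`. -/
theorem eco_implicit_master_weight_update
    {d : ℕ} (f : EuclideanSpace ℝ (Fin d) → ℝ) (hf : Differentiable ℝ f)
    (η β : ℝ) (hη : 0 < η) (hβ : β ∈ Set.Ioo (0 : ℝ) 1)
    (q : EuclideanSpace ℝ (Fin d) → EuclideanSpace ℝ (Fin d))
    (thetaHatIM mIM eIM mBar thetaTilde : ℕ → EuclideanSpace ℝ (Fin d))
    (hmBar : ∀ t, mBar (t + 1)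
      = β • mIM t + (1 - β) • gradient f (thetaHatIM t))
    (hthetaTilde : ∀ t, thetaTilde (t + 1) = thetaHatIM t - η • mBar (t + 1))
    (hthetaHatIM : ∀ t, thetaHatIM (t + 1) = q (thetaTilde (t + 1)))
    (heIM : ∀ t, eIM (t + 1) = thetaTilde (t + 1) - thetaHatIM (t + 1))
    (hmIM : ∀ t, mIM (t + 1)
      = mBar (t + 1) + (1 / η) • eIM t - (1 / (η * β)) • eIM (t + 1))
    (thetaStar mStar : ℕ → EuclideanSpace ℝ (Fin d))
    (hthetaStar : ∀ t, thetaStar t = thetaHatIM t + eIM t)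
    (hmStar : ∀ t, mStar t = mIM t + (1 / (η * β)) • eIM t) :
    ∀ t, thetaStar (t + 1) = thetaStar t - η • mStar (t + 1) := by
  intro t
  have hm : η • mStar (t + 1) = η • mBar (t + 1) + eIM t := by
    rw [hmStar, hmIM, sub_add_cancel, smul_add, smul_smul, mul_one_div_cancel hη.ne', one_smul]
  rw [hm, hthetaStar, hthetaStar, heIM, hthetaTilde]
  abel
end

section
/- Stationary second moments of SGDM with master weights on a quadratic (Appendix C): Let L > 0, σ² ≥ 0, β ∈ (0,1), and 0 < η < 2(1+β)/((1−β)L). Set c = (1−β)L, a = 1 − ηc, b = −ηβ, d = β. Suppose real numbers u, v, w satisfy the stationary system u = a²u + 2ab·v + b²w + η²c²σ², v = ac·u + (ad+bc)·v + bd·w − ηc²σ², and w = c²u + 2cd·v + d²w + c²σ². Then v = L²ησ²(β−1)/(2(1+β) − Lη(1−β)), w = 2L²σ²(1−β)/(2(1+β) − Lη(1−β)), and u = Lησ²(1+β)/(2(1+β) − Lη(1−β)). -/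
/-- **Stationary second moments of SGDM with master weights on a quadratic
(Appendix C).** If `u, v, w` satisfy the stationary second-moment system of
SGDM with master weights on `f(x) = (L/2)x²` (with `c = (1−β)L`, `a = 1 − ηc`,
`b = −ηβ`, `d = β`), then `v`, `w` and `u` have the displayed closed forms. -/
theorem sgdm_master_weights_stationary_moments
    (L σsq β η u v w : ℝ)
    (hL : 0 < L) (hσ : 0 ≤ σsq) (hβ : β ∈ Set.Ioo (0 : ℝ) 1)
    (hη : 0 < η) (hη' : η < 2 * (1 + β) / ((1 - β) * L))
    (c a b d : ℝ)
    (hc : c = (1 - β) * L) (ha : a = 1 - η * c) (hb : b = -(η * β)) (hd : d = β)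
    (hu : u = a ^ 2 * u + 2 * a * b * v + b ^ 2 * w + η ^ 2 * c ^ 2 * σsq)
    (hv : v = a * c * u + (a * d + b * c) * v + b * d * w - η * c ^ 2 * σsq)
    (hw : w = c ^ 2 * u + 2 * c * d * v + d ^ 2 * w + c ^ 2 * σsq) :
    v = L ^ 2 * η * σsq * (β - 1) / (2 * (1 + β) - L * η * (1 - β))
    ∧ w = 2 * L ^ 2 * σsq * (1 - β) / (2 * (1 + β) - L * η * (1 - β))
    ∧ u = L * η * σsq * (1 + β) / (2 * (1 + β) - L * η * (1 - β)) := by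
  obtain ⟨hβ0, hβ1⟩ := hβ
  have h1 : 0 < 1 - β := by linarith
  have hD : 0 < 2 * (1 + β) - L * η * (1 - β) := by
    rw [lt_div_iff₀ (by positivity)] at hη'
    linarith
  subst a b d
  have hvw : 2 * v = -(η * w) := by
    apply mul_left_cancel₀ hη.ne'
    linear_combination hu + 2 * η * hv + η ^ 2 * hw
  have huv : c * u = -((1 + β) * v) := by
    linear_combination hvw - hv - η * hw
  subst c
  have hvD : v * (2 * (1 + β) - L * η * (1 - β)) = L ^ 2 * η * σsq * (β - 1) := by
    apply mul_left_cancel₀ h1.ne'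
    linear_combination (1 - β ^ 2) * hvw - η * hw - η * (1 - β) * L * huv
  refine ⟨?_, ?_, ?_⟩ <;> rw [eq_div_iff hD.ne']
  · exact hvD
  · apply mul_left_cancel₀ hη.ne'
    linear_combination -2 * hvD + (2 * (1 + β) - L * η * (1 - β)) * hvw
  · apply mul_left_cancel₀ (mul_pos h1 hL).ne'
    linear_combination (2 * (1 + β) - L * η * (1 - β)) * huv - (1 + β) * hvD
end

section
/- Stationary second moment under naive master-weight removal (Appendix C, eq. n_u_final): Let L > 0, σ² ≥ 0, β ∈ (0,1), and 0 < η < 2(1+β)/((1−β)L). Set c = (1−β)L, a = 1 − ηc, b = −ηβ, d = β. Suppose real numbers u, v, w satisfy the stationary system u = a²u + 2ab·v + b²w + σ², v = ac·u + (ad+bc)·v + bd·w, and w = c²u + 2cd·v + d²w. Then u = σ²·((1−β²) + 2βLη) / (Lη·(2(1−β²) − Lη(1−β)²)). -/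
/-- **Stationary second moment under naive master-weight removal
(Appendix C, eq. n_u_final).** If `u, v, w` satisfy the stationary
second-moment system of naive SGDM without master weights on
`f(x) = (L/2)x²` (with `c = (1−β)L`, `a = 1 − ηc`, `b = −ηβ`, `d = β`), then
`u = σ²((1−β²) + 2βLη) / (Lη(2(1−β²) − Lη(1−β)²))`. -/
theorem naive_removal_stationary_second_moment
    (L σsq β η u v w : ℝ)
    (hL : 0 < L) (hσ : 0 ≤ σsq) (hβ : β ∈ Set.Ioo (0 : ℝ) 1)
    (hη : 0 < η) (hη' : η < 2 * (1 + β) / ((1 - β) * L))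
    (c a b d : ℝ)
    (hc : c = (1 - β) * L) (ha : a = 1 - η * c) (hb : b = -(η * β)) (hd : d = β)
    (hu : u = a ^ 2 * u + 2 * a * b * v + b ^ 2 * w + σsq)
    (hv : v = a * c * u + (a * d + b * c) * v + b * d * w)
    (hw : w = c ^ 2 * u + 2 * c * d * v + d ^ 2 * w) :
    u = σsq * ((1 - β ^ 2) + 2 * β * L * η)
        / (L * η * (2 * (1 - β ^ 2) - L * η * (1 - β) ^ 2)) := by
  obtain ⟨hβ0, hβ1⟩ := hβ
  have hβ' : 0 < 1 - β := sub_pos.mpr hβ1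
  have hstep : η * ((1 - β) * L) < 2 * (1 + β) := (lt_div_iff₀ (by positivity)).mp hη'
  have hden : 0 < 2 * (1 - β ^ 2) - L * η * (1 - β) ^ 2 := by
    linarith [mul_pos hβ' (sub_pos.mpr hstep)]
  rw [eq_div_iff (by positivity)]
  subst hd hb ha hc
  -- Cramer's rule: the multipliers are the cofactors of the first column.
  apply mul_left_cancel₀ hβ'.ne'
  linear_combination
    ((1 - ((1 - η * ((1 - d) * L)) * d + -(η * d) * ((1 - d) * L))) * (1 - d ^ 2)
        - 2 * (-(η * d)) * ((1 - d) * L) * d ^ 2) * hu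
      + (2 * (1 - η * ((1 - d) * L)) * (-(η * d)) * (1 - d ^ 2)
        + 2 * (η * d) ^ 2 * ((1 - d) * L) * d) * hv
      + (2 * (1 - η * ((1 - d) * L)) * (η * d) ^ 2 * d
        + (η * d) ^ 2
          * (1 - ((1 - η * ((1 - d) * L)) * d + -(η * d) * ((1 - d) * L)))) * hw
end

section
/- Intermediate stationary cross-moment under naive master-weight removal (Appendix C, eq. n_v_solve): Under the same hypotheses (L > 0, σ² ≥ 0, β ∈ (0,1), 0 < η < 2(1+β)/((1−β)L), c = (1−β)L, a = 1 − ηc, b = −ηβ, d = β, and real u, v, w satisfying u = a²u + 2ab·v + b²w + σ², v = ac·u + (ad+bc)·v + bd·w, w = c²u + 2cd·v + d²w), the stationary cross-moment satisfies v = −σ²·(Lη − β − 1) / (η·(2(1+β) − Lη(1−β))). -/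
/-- **Intermediate stationary cross-moment under naive master-weight removal
(Appendix C, eq. n_v_solve).** Under the stationary second-moment system of
naive SGDM without master weights on `f(x) = (L/2)x²`, the cross-moment
satisfies `v = −σ²(Lη − β − 1) / (η(2(1+β) − Lη(1−β)))`. -/
theorem naive_removal_stationary_cross_moment
    (L σsq β η u v w : ℝ)
    (hL : 0 < L) (hσ : 0 ≤ σsq) (hβ : β ∈ Set.Ioo (0 : ℝ) 1)
    (hη : 0 < η) (hη' : η < 2 * (1 + β) / ((1 - β) * L))
    (c a b d : ℝ)
    (hc : c = (1 - β) * L) (ha : a = 1 - η * c) (hb : b = -(η * β)) (hd : d = β)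
    (hu : u = a ^ 2 * u + 2 * a * b * v + b ^ 2 * w + σsq)
    (hv : v = a * c * u + (a * d + b * c) * v + b * d * w)
    (hw : w = c ^ 2 * u + 2 * c * d * v + d ^ 2 * w) :
    v = -(σsq * (L * η - β - 1)) / (η * (2 * (1 + β) - L * η * (1 - β))) := by
  subst hc ha hb hd
  obtain ⟨-, hd1⟩ := hβ
  have hd' : 0 < 1 - d := sub_pos.mpr hd1
  have hden : 0 < 2 * (1 + d) - L * η * (1 - d) := by
    rw [lt_div_iff₀ (mul_pos hd' hL)] at hη'
    linarith
  have hcross : (1 - d) * L * u = (1 - d) * v + η * w := by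
    linear_combination -hv - η * hw
  have hnoise : 2 * η * v + η ^ 2 * w = σsq := by
    linear_combination hu - 2 * η * hcross - η ^ 2 * hw
  have hmom : w * (1 + d - L * η) = L * (1 + d) * v := by
    apply mul_left_cancel₀ hd'.ne'
    linear_combination hw + (1 - d) * L * hcross
  rw [eq_div_iff (mul_pos hη hden).ne']
  linear_combination (1 + d - L * η) * hnoise - η ^ 2 * hmom
end

section
/- Stationary second moment of ECO on a quadratic (Appendix C, eq. e_u_final): Let L > 0, σ² ≥ 0, β ∈ (0,1), and 0 < η < 2(1+β)/((1−β)L). Set c = (1−β)L, a = 1 − ηc, b = −ηβ, d = β, and γ = (1−β)/(ηβ). Suppose real numbers u, v, w satisfy the stationary system u = a²u + 2ab·v + b²w + σ², v = ac·u + (ad+bc)·v + bd·w + γσ², and w = c²u + 2cd·v + d²w + γ²σ². Then u = 2σ² / (2(1−β²) − Lη(1−β)²). -/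
/-- **Stationary second moment of ECO on a quadratic (Appendix C,
eq. e_u_final).** If `u, v, w` satisfy the stationary second-moment system of
ECO on `f(x) = (L/2)x²` (with `c = (1−β)L`, `a = 1 − ηc`, `b = −ηβ`, `d = β`,
`γ = (1−β)/(ηβ)`), then `u = 2σ² / (2(1−β²) − Lη(1−β)²)`. -/
theorem eco_stationary_second_moment
    (L σsq β η u v w : ℝ)
    (hL : 0 < L) (hσ : 0 ≤ σsq) (hβ : β ∈ Set.Ioo (0 : ℝ) 1)
    (hη : 0 < η) (hη' : η < 2 * (1 + β) / ((1 - β) * L))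
    (c a b d γ : ℝ)
    (hc : c = (1 - β) * L) (ha : a = 1 - η * c) (hb : b = -(η * β)) (hd : d = β)
    (hγ : γ = (1 - β) / (η * β))
    (hu : u = a ^ 2 * u + 2 * a * b * v + b ^ 2 * w + σsq)
    (hv : v = a * c * u + (a * d + b * c) * v + b * d * w + γ * σsq)
    (hw : w = c ^ 2 * u + 2 * c * d * v + d ^ 2 * w + γ ^ 2 * σsq) :
    u = 2 * σsq / (2 * (1 - β ^ 2) - L * η * (1 - β) ^ 2) := by
  obtain ⟨hβ0, hβ1⟩ := hβ
  have hβ' : 0 < 1 - β := sub_pos.mpr hβ1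
  have hc0 : 0 < c := hc ▸ mul_pos hβ' hL
  have hγ' : η * β * γ = 1 - β := by
    rw [hγ]
    field_simp
  have hden : 0 < 2 * (1 - β ^ 2) - L * η * (1 - β) ^ 2 := by
    rw [lt_div_iff₀ (mul_pos hβ' hL)] at hη'
    nlinarith [mul_pos hβ' (sub_pos.mpr hη')]
  subst ha hb hd
  -- `P` stands for `η E[x̂ₜ (c x̂ₜ + β m̂ₜ)]`.
  obtain ⟨P, hP⟩ : ∃ P, P = η * c * u + d * (η * v) := ⟨_, rfl⟩
  have hW : η ^ 2 * w = 2 * P + (η ^ 2 * γ ^ 2 - 1) * σsq := by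
    linear_combination η ^ 2 * hw - hu - 2 * hP
  have hV : d * (η * v) = -d * P + σsq := by
    linear_combination d * η * hv + d * η ^ 2 * hw - d * hW - d * hP + σsq * hγ'
  have hP' : (1 + d) * P = η * c * u + σsq := by
    linear_combination hP + hV
  have hQ : 2 * P * (1 - d ^ 2 + η * c * d) =
      (η * c) ^ 2 * u + 2 * (η * c) * σsq + 2 * (1 - d) * σsq := by
    linear_combination η ^ 2 * hw - (1 - d ^ 2) * hW + 2 * η * c * hV +
      σsq * (η * d * γ + (1 - d)) * hγ'
  have key : (η * c) * (u * (2 * (1 - d ^ 2) - η * c * (1 - d))) = (η * c) * (2 * σsq) := by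
    linear_combination (1 + d) * hQ - 2 * (1 - d ^ 2 + η * c * d) * hP'
  rw [eq_div_iff hden.ne']
  have h := mul_left_cancel₀ (mul_pos hη hc0).ne' key
  rw [hc] at h
  linear_combination h
end
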